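/- The Dunkl operators ∇_i = ∂/∂z_i + β ∑_{j≠i} (1/(z_i - z_j))(1 - σ_{ij}), acting on polynomials in z_1,...,z_N (where σ_{ij} transposes the variables z_i and z_j), pairwise commute: [∇_i, ∇_j] = 0 for all i, j. -/

import Mathlib

open MvPolynomial Classical

/-- The transposition `σ_{ij}` of the variables `z_i` and `z_j`. -/
noncomputable def sigmaOp {K : Type*} [Field K] {N : ℕ} (i j : Fin N)
    (f : MvPolynomial (Fin N) K) : MvPolynomial (Fin N) K :=
  rename (Equiv.swap i j) f

/-- The divided-difference part `(z_i - z_j)⁻¹ (1 - σ_{ij}) f`, which is a polynomial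
since `(1 - σ_{ij}) f` is divisible by `z_i - z_j`. -/
noncomputable def divDiff {K : Type*} [Field K] {N : ℕ} (i j : Fin N)
    (f : MvPolynomial (Fin N) K) : MvPolynomial (Fin N) K :=
  if h : ∃ g : MvPolynomial (Fin N) K, f - sigmaOp i j f = (X i - X j) * g then
    Classical.choose h
  else 0

/-- The Dunkl operator `∇_i = ∂/∂z_i + β ∑_{j ≠ i} (z_i - z_j)⁻¹ (1 - σ_{ij})`. -/
noncomputable def dunkl {K : Type*} [Field K] {N : ℕ} (β : K) (i : Fin N)
    (f : MvPolynomial (Fin N) K) : MvPolynomial (Fin N) K :=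
  pderiv i f + C β * ∑ j ∈ Finset.univ.erase i, divDiff i j f

section LieAlgebra

variable {ι R L : Type*} [Fintype ι] [DecidableEq ι] [CommRing R] [LieRing L] [LieAlgebra R L]

/-- Sums `∑_{k ≠ i} d i k` commute when `d` is antisymmetric, commutes on disjoint pairs of
indices, and satisfies the classical Yang–Baxter equation. -/
lemma lie_sum_sum_eq_zero (d : ι → ι → L)
    (swap : ∀ {i j}, i ≠ j → d j i = -d i j)
    (disjoint : ∀ {i j k l}, i ≠ k → j ≠ l → i ≠ j → i ≠ l → k ≠ j → k ≠ l → ⁅d i k, d j l⁆ = 0)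
    (triple : ∀ {i j k}, i ≠ j → i ≠ k → j ≠ k →
      ⁅d i j, d j k⁆ + ⁅d i j, d i k⁆ + ⁅d i k, d j k⁆ = 0)
    {i j : ι} (hij : i ≠ j) :
    ⁅∑ k ∈ Finset.univ.erase i, d i k, ∑ l ∈ Finset.univ.erase j, d j l⁆ = 0 := by
  have hi : j ∈ Finset.univ.erase i := by simp [hij.symm]
  have hj : i ∈ Finset.univ.erase j := by simp [hij]
  rw [← Finset.add_sum_erase _ _ hi, ← Finset.add_sum_erase _ _ hj,
    Finset.erase_right_comm (a := j) (b := i), swap hij]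
  set P := (Finset.univ.erase i).erase j
  have hP : ∀ k ∈ P, i ≠ k ∧ j ≠ k := by
    intro k hk
    simp only [P, Finset.mem_erase, Finset.mem_univ, and_true] at hk
    exact ⟨hk.2.symm, hk.1.symm⟩
  have diagonal : ⁅∑ k ∈ P, d i k, ∑ l ∈ P, d j l⁆ = ∑ k ∈ P, ⁅d i k, d j k⁆ := by
    rw [sum_lie_sum]
    refine Finset.sum_congr rfl fun k hk => Finset.sum_eq_single_of_mem k hk fun l hl hlk => ?_
    exact disjoint (hP k hk).1 (hP l hl).2 hij (hP l hl).1 (hP k hk).2.symm hlk.symm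
  simp only [add_lie, lie_add, lie_neg, lie_self, zero_add]
  rw [lie_skew, diagonal, lie_sum, lie_sum, ← Finset.sum_add_distrib,
    ← Finset.sum_add_distrib]
  refine Finset.sum_eq_zero fun k hk => ?_
  rw [← triple hij (hP k hk).1 (hP k hk).2]
  abel

/-- An abstract criterion for operators of Dunkl type `p i + β ∑_{k ≠ i} d i k` to commute. -/
lemma lie_add_smul_sum_eq_zero (β : R) (p : ι → L) (d : ι → ι → L)
    (lie_p : ∀ i j, ⁅p i, p j⁆ = 0)
    (swap : ∀ {i j}, i ≠ j → d j i = -d i j)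
    (lie_p_d : ∀ {i j k}, i ≠ j → i ≠ k → j ≠ k → ⁅p i, d j k⁆ = 0)
    (lie_p_add_p : ∀ {i j}, i ≠ j → ⁅p i + p j, d i j⁆ = 0)
    (disjoint : ∀ {i j k l}, i ≠ k → j ≠ l → i ≠ j → i ≠ l → k ≠ j → k ≠ l → ⁅d i k, d j l⁆ = 0)
    (triple : ∀ {i j k}, i ≠ j → i ≠ k → j ≠ k →
      ⁅d i j, d j k⁆ + ⁅d i j, d i k⁆ + ⁅d i k, d j k⁆ = 0)
    {i j : ι} (hij : i ≠ j) :
    ⁅p i + β • ∑ k ∈ Finset.univ.erase i, d i k, p j + β • ∑ l ∈ Finset.univ.erase j, d j l⁆ =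
      0 := by
  have single : ∀ {i j : ι}, i ≠ j → ⁅p i, ∑ l ∈ Finset.univ.erase j, d j l⁆ = ⁅p i, d j i⁆ := by
    intro i j hij
    rw [lie_sum]
    refine Finset.sum_eq_single_of_mem i (by simp [hij]) fun l hl hli => ?_
    exact lie_p_d hij hli.symm (Finset.ne_of_mem_erase hl).symm
  have mixed : ⁅p i, ∑ l ∈ Finset.univ.erase j, d j l⁆ +
      ⁅∑ k ∈ Finset.univ.erase i, d i k, p j⁆ = 0 := by
    rw [← lie_skew (∑ k ∈ Finset.univ.erase i, d i k), single hij, single hij.symm, swap hij,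
      lie_neg, ← neg_add, ← add_lie,
      lie_p_add_p hij, neg_zero]
  rw [add_lie, lie_add, lie_add, lie_p, lie_smul, smul_lie, smul_lie, lie_smul,
    lie_sum_sum_eq_zero d swap disjoint triple hij, smul_zero, smul_zero, zero_add, add_zero,
    ← smul_add, mixed, smul_zero]

end LieAlgebra

section DividedDifferences

attribute [local instance] LieRing.ofAssociativeRing

variable {K : Type*} [Field K] {N : ℕ}

lemma X_sub_X_ne_zero {i j : Fin N} (h : i ≠ j) :
    (X i - X j : MvPolynomial (Fin N) K) ≠ 0 :=
  sub_ne_zero.2 fun e => h (X_injective e)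

lemma X_sub_X_dvd_sub_sigmaOp (i j : Fin N) (f : MvPolynomial (Fin N) K) :
    X i - X j ∣ f - sigmaOp i j f := by
  induction f using MvPolynomial.induction_on with
  | C a => simp [sigmaOp]
  | add p q hp hq =>
    convert dvd_add hp hq using 1
    simp only [sigmaOp, map_add]
    ring
  | mul_X p n hp =>
    have hX : (X i - X j : MvPolynomial (Fin N) K) ∣ X n - X (Equiv.swap i j n) := by
      rw [Equiv.swap_apply_def]
      split_ifs with h₁ h₂
      · rw [h₁]
      · rw [h₂, dvd_sub_comm]
      · simp
    convert dvd_add (hp.mul_right (X n)) (hX.mul_left (sigmaOp i j p)) using 1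
    simp only [sigmaOp, map_mul, rename_X]
    ring

lemma X_sub_X_mul_divDiff (i j : Fin N) (f : MvPolynomial (Fin N) K) :
    (X i - X j) * divDiff i j f = f - sigmaOp i j f := by
  have h : ∃ g, f - sigmaOp i j f = (X i - X j) * g := X_sub_X_dvd_sub_sigmaOp i j f
  rw [divDiff, dif_pos h]
  exact h.choose_spec.symm

lemma divDiff_eq_of_mul_eq {i j : Fin N} (h : i ≠ j) {f g : MvPolynomial (Fin N) K}
    (hg : (X i - X j) * g = f - sigmaOp i j f) : divDiff i j f = g :=
  mul_left_cancel₀ (X_sub_X_ne_zero h) ((X_sub_X_mul_divDiff i j f).trans hg.symm)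

lemma divDiff_swap {i j : Fin N} (h : i ≠ j) (f : MvPolynomial (Fin N) K) :
    divDiff j i f = -divDiff i j f := by
  refine divDiff_eq_of_mul_eq h.symm ?_
  have := X_sub_X_mul_divDiff i j f
  rw [sigmaOp, Equiv.swap_comm] at this
  rw [sigmaOp, ← this]
  ring

lemma divDiff_add {i j : Fin N} (h : i ≠ j) (f g : MvPolynomial (Fin N) K) :
    divDiff i j (f + g) = divDiff i j f + divDiff i j g := by
  refine divDiff_eq_of_mul_eq h ?_
  rw [mul_add, X_sub_X_mul_divDiff, X_sub_X_mul_divDiff]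
  simp only [sigmaOp, map_add]
  ring

lemma divDiff_smul {i j : Fin N} (h : i ≠ j) (c : K) (f : MvPolynomial (Fin N) K) :
    divDiff i j (c • f) = c • divDiff i j f := by
  refine divDiff_eq_of_mul_eq h ?_
  rw [mul_smul_comm, X_sub_X_mul_divDiff, smul_sub]
  simp only [sigmaOp, map_smul]

lemma divDiff_neg {i j : Fin N} (h : i ≠ j) (f : MvPolynomial (Fin N) K) :
    divDiff i j (-f) = -divDiff i j f := by
  rw [← neg_one_smul K f, divDiff_smul h, neg_one_smul]

lemma rename_divDiff (e : Equiv.Perm (Fin N)) {i j : Fin N} (h : i ≠ j)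
    (f : MvPolynomial (Fin N) K) :
    rename e (divDiff i j f) = divDiff (e i) (e j) (rename e f) := by
  refine (divDiff_eq_of_mul_eq (e.injective.ne h) ?_).symm
  have := congrArg (rename e) (X_sub_X_mul_divDiff i j f)
  simp only [map_mul, map_sub, rename_X, sigmaOp, rename_rename] at this
  rw [this, sigmaOp, rename_rename]
  congr 3
  ext x
  simp [Equiv.swap_apply_def, apply_ite e]

lemma sigmaOp_sigmaOp (a b i j : Fin N) (f : MvPolynomial (Fin N) K) :
    sigmaOp a b (sigmaOp i j f) =
      sigmaOp (Equiv.swap a b i) (Equiv.swap a b j) (sigmaOp a b f) := by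
  simp only [sigmaOp, rename_rename, ← Equiv.Perm.coe_mul]
  rw [Equiv.swap_apply_apply, inv_mul_cancel_right]

lemma sigmaOp_divDiff (a b : Fin N) {i j : Fin N} (h : i ≠ j) (f : MvPolynomial (Fin N) K) :
    sigmaOp a b (divDiff i j f) =
      divDiff (Equiv.swap a b i) (Equiv.swap a b j) (sigmaOp a b f) :=
  rename_divDiff _ h f

lemma pderiv_rename_perm (e : Equiv.Perm (Fin N)) (i : Fin N) (f : MvPolynomial (Fin N) K) :
    pderiv (e i) (rename e f) = rename e (pderiv i f) :=
  pderiv_rename e.injective i f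

/-- The divided difference `(z_i - z_j)⁻¹ (1 - σ_{ij})` as an endomorphism, zero if `i = j`. -/
noncomputable def divDiffEnd (K : Type*) [Field K] {N : ℕ} (i j : Fin N) :
    Module.End K (MvPolynomial (Fin N) K) where
  toFun f := if i = j then 0 else divDiff i j f
  map_add' f g := by
    split_ifs with h
    · simp
    · exact divDiff_add h f g
  map_smul' c f := by
    split_ifs with h
    · simp
    · exact divDiff_smul h c f

lemma divDiffEnd_apply {i j : Fin N} (h : i ≠ j) (f : MvPolynomial (Fin N) K) :
    divDiffEnd K i j f = divDiff i j f :=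
  if_neg h

lemma divDiffEnd_swap {i j : Fin N} (h : i ≠ j) :
    (divDiffEnd K j i : Module.End K (MvPolynomial (Fin N) K)) = -divDiffEnd K i j := by
  refine LinearMap.ext fun f => ?_
  rw [LinearMap.neg_apply, divDiffEnd_apply h, divDiffEnd_apply h.symm, divDiff_swap h]

lemma lie_divDiffEnd_of_disjoint {i j k l : Fin N} (hik : i ≠ k) (hjl : j ≠ l) (hij : i ≠ j)
    (hil : i ≠ l) (hkj : k ≠ j) (hkl : k ≠ l) :
    ⁅(divDiffEnd K i k : Module.End K (MvPolynomial (Fin N) K)), divDiffEnd K j l⁆ = 0 := by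
  rw [Ring.lie_def, sub_eq_zero]
  refine LinearMap.ext fun f => ?_
  simp only [Module.End.mul_apply, divDiffEnd_apply hik, divDiffEnd_apply hjl]
  refine divDiff_eq_of_mul_eq hik (mul_left_cancel₀ (X_sub_X_ne_zero hjl) ?_)
  rw [sigmaOp_divDiff _ _ hjl, Equiv.swap_apply_of_ne_of_ne hij.symm hkj.symm,
    Equiv.swap_apply_of_ne_of_ne hil.symm hkl.symm, mul_left_comm, X_sub_X_mul_divDiff,
    mul_sub, mul_sub, sigmaOp_divDiff _ _ hik, Equiv.swap_apply_of_ne_of_ne hij hil,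
    Equiv.swap_apply_of_ne_of_ne hkj hkl]
  simp only [X_sub_X_mul_divDiff]
  have : sigmaOp i k (sigmaOp j l f) = sigmaOp j l (sigmaOp i k f) := by
    rw [sigmaOp_sigmaOp, Equiv.swap_apply_of_ne_of_ne hij.symm hkj.symm,
      Equiv.swap_apply_of_ne_of_ne hil.symm hkl.symm]
  rw [this]
  ring

/-- Clearing denominators in `Δ_{ab} Δ_{bc} f`. -/
lemma mul_divDiff_divDiff {a b c : Fin N} (hbc : b ≠ c) (hac : a ≠ c)
    (f : MvPolynomial (Fin N) K) :
    (X a - X b) * (X b - X c) * (X a - X c) * divDiff a b (divDiff b c f) =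
      (X a - X c) * (f - sigmaOp b c f) -
        (X b - X c) * (sigmaOp a b f - sigmaOp a c (sigmaOp a b f)) := by
  have h := X_sub_X_mul_divDiff a b (divDiff b c f)
  rw [sigmaOp_divDiff _ _ hbc, Equiv.swap_apply_right,
    Equiv.swap_apply_of_ne_of_ne hac.symm hbc.symm] at h
  linear_combination (X b - X c) * (X a - X c) * h + (X a - X c) * X_sub_X_mul_divDiff b c f -
    (X b - X c) * X_sub_X_mul_divDiff a c (sigmaOp a b f)

lemma sigmaOp_comm (a b : Fin N) (f : MvPolynomial (Fin N) K) :
    sigmaOp a b f = sigmaOp b a f := by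
  rw [sigmaOp, Equiv.swap_comm, sigmaOp]

lemma lie_divDiffEnd_triple {i j k : Fin N} (hij : i ≠ j) (hik : i ≠ k) (hjk : j ≠ k) :
    ⁅(divDiffEnd K i j : Module.End K (MvPolynomial (Fin N) K)), divDiffEnd K j k⁆ +
      ⁅divDiffEnd K i j, divDiffEnd K i k⁆ + ⁅divDiffEnd K i k, divDiffEnd K j k⁆ = 0 := by
  refine LinearMap.ext fun f => ?_
  simp only [Ring.lie_def, LinearMap.sub_apply, LinearMap.add_apply, LinearMap.zero_apply,
    Module.End.mul_apply, divDiffEnd_apply hij, divDiffEnd_apply hik, divDiffEnd_apply hjk]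
  refine mul_left_cancel₀ (mul_ne_zero (mul_ne_zero (X_sub_X_ne_zero hij) (X_sub_X_ne_zero hjk))
    (X_sub_X_ne_zero hik)) ?_
  have h₁ := mul_divDiff_divDiff hjk hik f
  have h₂ := mul_divDiff_divDiff hij.symm hik.symm f
  have h₃ := mul_divDiff_divDiff hij hjk.symm f
  have h₄ := mul_divDiff_divDiff hik hjk f
  have h₅ := mul_divDiff_divDiff hik.symm hij.symm f
  have h₆ := mul_divDiff_divDiff hjk.symm hij f
  simp only [divDiff_swap hij, divDiff_swap hik, divDiff_swap hjk,
    divDiff_neg hik, divDiff_neg hjk] at h₁ h₂ h₃ h₄ h₅ h₆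
  rw [sigmaOp_comm k i, sigmaOp_comm k j, sigmaOp_comm j i] at *
  have c₁ : sigmaOp i k (sigmaOp i j f) = sigmaOp j k (sigmaOp i k f) := by
    rw [sigmaOp_sigmaOp i k i j, Equiv.swap_apply_left,
      Equiv.swap_apply_of_ne_of_ne hij.symm hjk, sigmaOp_comm k j]
  have c₂ : sigmaOp j k (sigmaOp i k f) = sigmaOp i j (sigmaOp j k f) := by
    rw [sigmaOp_sigmaOp j k i k, Equiv.swap_apply_right,
      Equiv.swap_apply_of_ne_of_ne hij hik]
  have c₃ : sigmaOp i k (sigmaOp j k f) = sigmaOp i j (sigmaOp i k f) := by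
    rw [sigmaOp_sigmaOp i k j k, Equiv.swap_apply_right,
      Equiv.swap_apply_of_ne_of_ne hij.symm hjk, sigmaOp_comm j i]
  have c₄ : sigmaOp j k (sigmaOp i j f) = sigmaOp i k (sigmaOp j k f) := by
    rw [sigmaOp_sigmaOp j k i j, Equiv.swap_apply_left,
      Equiv.swap_apply_of_ne_of_ne hij hik]
  rw [c₁, c₂] at h₁
  rw [c₂] at h₃
  rw [c₄, c₃] at h₄
  rw [c₃] at h₂
  linear_combination h₁ + h₂ + h₃ + h₄ + h₅ + h₆

lemma lie_pderiv_divDiffEnd {i j k : Fin N} (hij : i ≠ j) (hik : i ≠ k) (hjk : j ≠ k) :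
    ⁅((pderiv i).toLinearMap : Module.End K (MvPolynomial (Fin N) K)), divDiffEnd K j k⁆ = 0 := by
  rw [Ring.lie_def, sub_eq_zero]
  refine LinearMap.ext fun f => ?_
  simp only [Module.End.mul_apply, divDiffEnd_apply hjk,
    Derivation.coeFn_coe]
  refine (divDiff_eq_of_mul_eq hjk ?_).symm
  have h := congrArg (pderiv i) (X_sub_X_mul_divDiff j k f)
  have hs := pderiv_rename_perm (Equiv.swap j k) i f
  rw [Equiv.swap_apply_of_ne_of_ne hij hik] at hs
  simpa [sigmaOp, pderiv_X_of_ne hij.symm, pderiv_X_of_ne hik.symm, hs] using h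

lemma lie_pderiv_add_pderiv_divDiffEnd {i j : Fin N} (hij : i ≠ j) :
    ⁅((pderiv i).toLinearMap + (pderiv j).toLinearMap :
      Module.End K (MvPolynomial (Fin N) K)), divDiffEnd K i j⁆ = 0 := by
  rw [Ring.lie_def, sub_eq_zero]
  refine LinearMap.ext fun f => ?_
  simp only [Module.End.mul_apply, divDiffEnd_apply hij,
    Derivation.coeFn_coe, LinearMap.add_apply]
  refine (divDiff_eq_of_mul_eq hij ?_).symm
  have hi := congrArg (pderiv i) (X_sub_X_mul_divDiff i j f)
  have hj := congrArg (pderiv j) (X_sub_X_mul_divDiff i j f)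
  have hsi := pderiv_rename_perm (Equiv.swap i j) i f
  have hsj := pderiv_rename_perm (Equiv.swap i j) j f
  rw [Equiv.swap_apply_left] at hsi
  rw [Equiv.swap_apply_right] at hsj
  simp only [sigmaOp, map_sub, map_add, Derivation.leibniz, pderiv_X_self,
    pderiv_X_of_ne hij, pderiv_X_of_ne hij.symm, smul_eq_mul, hsi, hsj] at hi hj ⊢
  linear_combination hi + hj

lemma lie_pderiv_pderiv (i j : Fin N) :
    ⁅((pderiv i).toLinearMap : Module.End K (MvPolynomial (Fin N) K)),
      (pderiv (R := K) j).toLinearMap⁆ = 0 := by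
  have h : ⁅pderiv (R := K) i, pderiv (R := K) j⁆ = 0 := by
    refine derivation_ext fun n => ?_
    simp [Derivation.commutator_apply, pderiv_X, Pi.single_apply, apply_ite (pderiv _)]
  simpa using congrArg Derivation.toLinearMap h

/-- The Dunkl operator as an endomorphism. -/
noncomputable def dunklEnd (β : K) (i : Fin N) : Module.End K (MvPolynomial (Fin N) K) :=
  (pderiv i).toLinearMap + β • ∑ j ∈ Finset.univ.erase i, divDiffEnd K i j

lemma dunklEnd_apply (β : K) (i : Fin N) (f : MvPolynomial (Fin N) K) :
    dunklEnd β i f = dunkl β i f := by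
  simp only [dunklEnd, dunkl, LinearMap.add_apply, LinearMap.smul_apply, LinearMap.sum_apply,
    smul_eq_C_mul]
  congr 2
  exact Finset.sum_congr rfl fun j hj => divDiffEnd_apply (Finset.ne_of_mem_erase hj).symm f

lemma lie_dunklEnd (β : K) {i j : Fin N} (hij : i ≠ j) :
    ⁅dunklEnd β i, dunklEnd β j⁆ = 0 := by
  refine lie_add_smul_sum_eq_zero (L := Module.End K (MvPolynomial (Fin N) K)) β
    (fun i => (pderiv i).toLinearMap) (divDiffEnd K) ?_ ?_ ?_ ?_ ?_ ?_ hij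
  · exact lie_pderiv_pderiv
  · exact divDiffEnd_swap
  · exact lie_pderiv_divDiffEnd
  · exact lie_pderiv_add_pderiv_divDiffEnd
  · exact lie_divDiffEnd_of_disjoint
  · exact lie_divDiffEnd_triple

end DividedDifferences

/-- Dunkl operators pairwise commute: `[∇_i, ∇_j] = 0`. -/
theorem dunkl_commute {K : Type*} [Field K] [CharZero K] {N : ℕ} (hN : 2 ≤ N)
    (β : K) (i j : Fin N) (f : MvPolynomial (Fin N) K) :
    dunkl β i (dunkl β j f) = dunkl β j (dunkl β i f) := by
  rcases eq_or_ne i j with rfl | hij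
  · rfl
  have h := lie_dunklEnd β hij
  rw [Ring.lie_def, sub_eq_zero] at h
  simp only [← dunklEnd_apply, ← Module.End.mul_apply, h]
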